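/- Existence for weights ‖x‖ⁿV with decreasing V (Corollary 1.8, existence part). Let β ≠ 0 and n > -2 with n > β-2. Let V : ℝ² → ℝ be nonnegative, not identically zero, radially symmetric and radially decreasing (V(x) ≤ V(y) whenever ‖x‖ ≥ ‖y‖), continuous on ℝ² and continuously differentiable on ℝ²∖{0}, and suppose its radial profile v (V(x) = v(‖x‖)) is such that r ↦ r·v'(r) extends continuously to [0,∞). Assume moreover: if β>0, then ∫₁^∞ r^{n+1-β+δ}·v(r) dr < ∞ for some δ>0; if β<0, then ∫₁^∞ r^{n+1-2β}·v(r) dr < ∞. Then there exists a radially symmetric ψ : ℝ² → ℝ, continuously differentiable on ℝ²∖{0} and, for some exponent α ∈ (0,1], α-Hölder continuous on every compact subset of ℝ², such that ψ is a weak solution of -Δψ = 4πβ·‖x‖ⁿ·V(x)·e^{ψ(x)} on ℝ², ∫_{ℝ²} ‖x‖ⁿ·V(x)·e^{ψ(x)} dx = 1, and ψ(x)/log‖x‖ → -2β as ‖x‖ → ∞. -/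

import Mathlib

open MeasureTheory Real Filter Bornology Metric
open scoped NNReal

noncomputable section

abbrev R2 : Type := EuclideanSpace ℝ (Fin 2)

/-- The Laplacian of `f : ℝ² → ℝ`, via the second iterated Fréchet derivative. -/
def lap (f : R2 → ℝ) (x : R2) : ℝ :=
  ∑ i : Fin 2, iteratedFDeriv ℝ 2 f x ![EuclideanSpace.single i 1, EuclideanSpace.single i 1]

/-- `ψ` is a weak (distributional) solution of `-Δψ = g` on `ℝ²`:
for every smooth compactly supported test function `φ`, `∫ ψ·Δφ = -∫ g·φ`. -/
def IsWeakSol (ψ g : R2 → ℝ) : Prop :=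
  ∀ φ : R2 → ℝ, ContDiff ℝ (⊤ : ℕ∞) φ → HasCompactSupport φ →
    ∫ x : R2, ψ x * lap φ x = -∫ x : R2, g x * φ x

/-- `f` is radially symmetric. -/
def RadSym (f : R2 → ℝ) : Prop := ∀ x y : R2, ‖x‖ = ‖y‖ → f x = f y

/-- The unit vector at angle `θ`. -/
def circleVec (θ : ℝ) : R2 := !₂[cos θ, sin θ]

/-- The counterclockwise unit tangent vector at angle `θ`. -/
def circleTan (θ : ℝ) : R2 := !₂[-sin θ, cos θ]

lemma circleVec_eq (θ : ℝ) : circleVec θ =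
    cos θ • EuclideanSpace.single (0 : Fin 2) (1 : ℝ) +
      sin θ • EuclideanSpace.single (1 : Fin 2) (1 : ℝ) := by
  ext i; fin_cases i <;> simp [circleVec]

lemma circleTan_eq (θ : ℝ) : circleTan θ =
    (-sin θ) • EuclideanSpace.single (0 : Fin 2) (1 : ℝ) +
      cos θ • EuclideanSpace.single (1 : Fin 2) (1 : ℝ) := by
  ext i; fin_cases i <;> simp [circleTan]

lemma hasDerivAt_circleVec (θ : ℝ) : HasDerivAt circleVec (circleTan θ) θ := by
  rw [funext circleVec_eq, circleTan_eq]
  exact ((hasDerivAt_cos θ).smul_const _).add ((hasDerivAt_sin θ).smul_const _)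

lemma hasDerivAt_circleTan (θ : ℝ) : HasDerivAt circleTan (-circleVec θ) θ := by
  rw [funext circleTan_eq, circleVec_eq, neg_add, ← neg_smul, ← neg_smul]
  exact ((hasDerivAt_sin θ).neg.smul_const _).add ((hasDerivAt_cos θ).smul_const _)

lemma continuous_circleVec : Continuous circleVec :=
  continuous_iff_continuousAt.2 fun θ => (hasDerivAt_circleVec θ).continuousAt

lemma continuous_circleTan : Continuous circleTan :=
  continuous_iff_continuousAt.2 fun θ => (hasDerivAt_circleTan θ).continuousAt

lemma norm_circleVec (θ : ℝ) : ‖circleVec θ‖ = 1 := by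
  simp [circleVec, EuclideanSpace.norm_eq]

lemma lap_eq_polar (f : R2 → ℝ) (x : R2) (θ : ℝ) :
    lap f x = fderiv ℝ (fderiv ℝ f) x (circleVec θ) (circleVec θ) +
      fderiv ℝ (fderiv ℝ f) x (circleTan θ) (circleTan θ) := by
  simp only [lap, Fin.sum_univ_two, iteratedFDeriv_two_apply, circleVec_eq, circleTan_eq,
    map_add, map_smul, add_apply, smul_apply,
    smul_eq_mul, Matrix.cons_val_zero, Matrix.cons_val_one]
  linear_combination (-(fderiv ℝ (fderiv ℝ f) x (EuclideanSpace.single (0 : Fin 2) (1 : ℝ))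
    (EuclideanSpace.single (0 : Fin 2) (1 : ℝ))) - fderiv ℝ (fderiv ℝ f) x
    (EuclideanSpace.single (1 : Fin 2) (1 : ℝ)) (EuclideanSpace.single (1 : Fin 2) (1 : ℝ))) *
    sin_sq_add_cos_sq θ

section CircleMeans

variable {φ : R2 → ℝ}

lemma continuous_lap (hφ : ContDiff ℝ 2 φ) : Continuous (lap φ) := by
  unfold lap
  refine continuous_finsetSum _ fun i _ => ?_
  exact (ContinuousMultilinearMap.apply ℝ (fun _ : Fin 2 => R2) ℝ _).continuous.comp
    (hφ.continuous_iteratedFDeriv le_rfl)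

lemma lap_eq_zero_of_notMem_tsupport {x : R2} (hx : x ∉ tsupport φ) : lap φ x = 0 := by
  have h : iteratedFDeriv ℝ 2 φ x = 0 := by
    by_contra h0
    exact hx (support_iteratedFDeriv_subset (𝕜 := ℝ) 2 h0)
  simp [lap, h]

/-- The integral over angles of `φ` on the circle of radius `r`. -/
def circleInt (φ : R2 → ℝ) (r : ℝ) : ℝ := ∫ θ in (-π)..π, φ (r • circleVec θ)

/-- The integral over angles of the radial derivative of `φ` on the circle of radius `r`. -/
def circleRadial (φ : R2 → ℝ) (r : ℝ) : ℝ :=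
  ∫ θ in (-π)..π, fderiv ℝ φ (r • circleVec θ) (circleVec θ)

lemma continuous_circleInt (hφ : Continuous φ) : Continuous (circleInt φ) := by
  unfold circleInt
  refine intervalIntegral.continuous_parametric_intervalIntegral_of_continuous' ?_ _ _
  have := continuous_circleVec
  fun_prop

lemma hasDerivAt_circleInt (hφ : ContDiff ℝ 1 φ) (hc : HasCompactSupport φ) (r : ℝ) :
    HasDerivAt (circleInt φ) (circleRadial φ r) r := by
  have hv := continuous_circleVec
  have hD : Continuous (fderiv ℝ φ) := hφ.continuous_fderiv one_ne_zero
  have hφc := hφ.continuous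
  obtain ⟨C, hC⟩ := hD.bounded_above_of_compact_support (hc.fderiv ℝ)
  refine (intervalIntegral.hasDerivAt_integral_of_dominated_loc_of_deriv_le
    (F := fun r θ => φ (r • circleVec θ))
    (F' := fun r θ => fderiv ℝ φ (r • circleVec θ) (circleVec θ)) (bound := fun _ => C)
    (s := Set.univ) Filter.univ_mem ?_ ?_ ?_ ?_ ?_ ?_).2
  · exact Eventually.of_forall fun x => (by fun_prop : Continuous _).aestronglyMeasurable
  · exact (by fun_prop : Continuous _).intervalIntegrable _ _
  · exact (by fun_prop : Continuous _).aestronglyMeasurable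
  · refine Eventually.of_forall fun θ _ x _ => ?_
    refine (ContinuousLinearMap.le_opNorm _ _).trans ?_
    rw [norm_circleVec, mul_one]
    exact hC _
  · exact intervalIntegrable_const
  · refine Eventually.of_forall fun θ _ x _ => ?_
    have h1 : HasDerivAt (fun r : ℝ => r • circleVec θ) (circleVec θ) x := by
      simpa using (hasDerivAt_id x).smul_const (circleVec θ)
    exact ((hφ.differentiable one_ne_zero).differentiableAt (x := x • circleVec θ)
      ).hasFDerivAt.comp_hasDerivAt x h1

lemma hasDerivAt_circleRadial (hφ : ContDiff ℝ 2 φ) (r : ℝ) :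
    HasDerivAt (circleRadial φ) (∫ θ in (-π)..π,
      fderiv ℝ (fderiv ℝ φ) (r • circleVec θ) (circleVec θ) (circleVec θ)) r := by
  have hv := continuous_circleVec
  have hφ1 : ContDiff ℝ 1 (fderiv ℝ φ) := hφ.fderiv_right (by norm_num)
  have hD : Continuous (fderiv ℝ φ) := hφ1.continuous
  have hD2 : Continuous (fderiv ℝ (fderiv ℝ φ)) := hφ1.continuous_fderiv one_ne_zero
  have hc2 : Continuous fun p : ℝ × ℝ =>
      fderiv ℝ (fderiv ℝ φ) (p.1 • circleVec p.2) (circleVec p.2) (circleVec p.2) := by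
    fun_prop
  obtain ⟨C, hC⟩ := ((isCompact_Icc (a := r - 1) (b := r + 1)).prod
    (isCompact_Icc (a := -π) (b := π))).exists_bound_of_continuousOn hc2.continuousOn
  have hF (x : ℝ) : Continuous fun θ => fderiv ℝ φ (x • circleVec θ) (circleVec θ) := by
    fun_prop
  have hF' : Continuous fun θ =>
      fderiv ℝ (fderiv ℝ φ) (r • circleVec θ) (circleVec θ) (circleVec θ) := by
    fun_prop
  have hd (x θ : ℝ) : HasDerivAt (fun r => fderiv ℝ φ (r • circleVec θ) (circleVec θ))
      (fderiv ℝ (fderiv ℝ φ) (x • circleVec θ) (circleVec θ) (circleVec θ)) x := by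
    have h1 : HasDerivAt (fun r : ℝ => r • circleVec θ) (circleVec θ) x := by
      simpa using (hasDerivAt_id x).smul_const (circleVec θ)
    have h2 := (hφ1.differentiable one_ne_zero
      (x • circleVec θ)).hasFDerivAt.comp_hasDerivAt x h1
    simpa using h2.clm_apply (hasDerivAt_const x (circleVec θ))
  exact (intervalIntegral.hasDerivAt_integral_of_dominated_loc_of_deriv_le
    (bound := fun _ => C) (Icc_mem_nhds (sub_one_lt r) (lt_add_one r))
    (Eventually.of_forall fun x => (hF x).aestronglyMeasurable)
    ((hF r).intervalIntegrable _ _) hF'.aestronglyMeasurable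
    (Eventually.of_forall fun θ hθ x hx => hC (x, θ) ⟨hx, by
      rw [Set.uIoc_of_le (by linarith [pi_pos])] at hθ
      exact Set.Ioc_subset_Icc_self hθ⟩) intervalIntegrable_const
    (Eventually.of_forall fun θ _ x _ => hd x θ)).2

lemma mul_integral_circleTan_eq (hφ : ContDiff ℝ 2 φ) (r : ℝ) :
    r * ∫ θ in (-π)..π, fderiv ℝ (fderiv ℝ φ) (r • circleVec θ) (circleTan θ) (circleTan θ) =
      circleRadial φ r := by
  have hv := continuous_circleVec
  have hw := continuous_circleTan
  have hφ1 : ContDiff ℝ 1 (fderiv ℝ φ) := hφ.fderiv_right (by norm_num)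
  have hD : Continuous (fderiv ℝ φ) := hφ1.continuous
  have hD2 : Continuous (fderiv ℝ (fderiv ℝ φ)) := hφ1.continuous_fderiv one_ne_zero
  have hc1 : Continuous fun θ => r * fderiv ℝ (fderiv ℝ φ) (r • circleVec θ) (circleTan θ)
      (circleTan θ) := by fun_prop
  have hc2 : Continuous fun θ => fderiv ℝ φ (r • circleVec θ) (circleVec θ) := by fun_prop
  have hd : ∀ θ ∈ Set.uIcc (-π) π,
      HasDerivAt (fun θ => fderiv ℝ φ (r • circleVec θ) (circleTan θ))
      (r * fderiv ℝ (fderiv ℝ φ) (r • circleVec θ) (circleTan θ)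
      (circleTan θ) - fderiv ℝ φ (r • circleVec θ) (circleVec θ)) θ := by
    intro θ _
    have h1 : HasDerivAt (fun θ : ℝ => r • circleVec θ) (r • circleTan θ) θ :=
      (hasDerivAt_circleVec θ).const_smul r
    have h2 := (hφ1.differentiable one_ne_zero
      (r • circleVec θ)).hasFDerivAt.comp_hasDerivAt θ h1
    have h3 := h2.clm_apply (hasDerivAt_circleTan θ)
    simpa [sub_eq_add_neg] using h3
  have h2 := intervalIntegral.integral_eq_sub_of_hasDerivAt hd
    ((hc1.sub hc2).intervalIntegrable _ _)
  rw [intervalIntegral.integral_sub (hc1.intervalIntegrable _ _) (hc2.intervalIntegrable _ _),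
    intervalIntegral.integral_const_mul] at h2
  rw [← sub_eq_zero, circleRadial, h2]
  simp [circleVec, circleTan]

lemma hasDerivAt_mul_circleRadial (hφ : ContDiff ℝ 2 φ) (r : ℝ) :
    HasDerivAt (fun r => r * circleRadial φ r) (r * circleInt (lap φ) r) r := by
  have hv := continuous_circleVec
  have hw := continuous_circleTan
  have hφ1 : ContDiff ℝ 1 (fderiv ℝ φ) := hφ.fderiv_right (by norm_num)
  have hD2 : Continuous (fderiv ℝ (fderiv ℝ φ)) := hφ1.continuous_fderiv one_ne_zero
  have h4 : circleInt (lap φ) r = (∫ θ in (-π)..π,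
      fderiv ℝ (fderiv ℝ φ) (r • circleVec θ) (circleVec θ) (circleVec θ)) +
      ∫ θ in (-π)..π,
      fderiv ℝ (fderiv ℝ φ) (r • circleVec θ) (circleTan θ) (circleTan θ) := by
    rw [← intervalIntegral.integral_add ((by fun_prop : Continuous _).intervalIntegrable _ _)
      ((by fun_prop : Continuous _).intervalIntegrable _ _)]
    exact intervalIntegral.integral_congr fun θ _ => lap_eq_polar φ _ θ
  refine ((hasDerivAt_id r).mul (hasDerivAt_circleRadial hφ r)).congr_deriv ?_
  rw [h4, mul_add, mul_integral_circleTan_eq hφ]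
  simp [add_comm]

end CircleMeans

lemma integral_eq_integral_polar (F : R2 → ℝ) :
    ∫ x, F x = ∫ p in Set.Ioi (0 : ℝ) ×ˢ Set.Ioo (-π) π, p.1 * F (p.1 • circleVec p.2) := by
  have h := (Complex.orthonormalBasisOneI.repr.measurePreserving).integral_comp
    Complex.orthonormalBasisOneI.repr.toHomeomorph.measurableEmbedding F
  rw [← h, ← Complex.integral_comp_polarCoord_symm]
  refine setIntegral_congr_fun (measurableSet_Ioi.prod measurableSet_Ioo) fun p _ => ?_
  simp only [smul_eq_mul]
  congr 2
  ext i
  fin_cases i <;> simp [circleVec, Complex.cos_ofReal_re, Complex.sin_ofReal_re]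

/-- Integration in polar coordinates of a radial function times a continuous function vanishing
outside a ball. -/
lemma integral_radial_mul {h : ℝ → ℝ} {f : R2 → ℝ} {R : ℝ} (hR : 0 ≤ R)
    (hf : Continuous f) (hfR : ∀ x, R < ‖x‖ → f x = 0)
    (hh : IntegrableOn (fun r => r * h r) (Set.Ioc 0 R)) :
    ∫ x : R2, h ‖x‖ * f x = ∫ r in (0 : ℝ)..R, r * h r * circleInt f r := by
  have hv := continuous_circleVec
  set k : ℝ → ℝ := (Set.Ioc 0 R).indicator fun r => r * h r with hk
  have hki : Integrable k (volume.restrict (Set.Ioi 0)) :=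
    ((integrable_indicator_iff measurableSet_Ioc).2 hh).integrableOn
  have hcs : HasCompactSupport f :=
    HasCompactSupport.intro (isCompact_closedBall (0 : R2) R) fun x hx =>
      hfR x (by simpa using hx)
  obtain ⟨C, hC⟩ := hf.bounded_above_of_compact_support hcs
  rw [integral_eq_integral_polar]
  have h1 : ∫ p in Set.Ioi (0 : ℝ) ×ˢ Set.Ioo (-π) π,
      p.1 * (h ‖p.1 • circleVec p.2‖ * f (p.1 • circleVec p.2)) =
      ∫ p in Set.Ioi (0 : ℝ) ×ˢ Set.Ioo (-π) π, k p.1 * f (p.1 • circleVec p.2) := by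
    refine setIntegral_congr_fun (measurableSet_Ioi.prod measurableSet_Ioo) ?_
    rintro ⟨r, θ⟩ ⟨hr, -⟩
    have hr : 0 < r := hr
    have hn : ‖r • circleVec θ‖ = r := by
      rw [norm_smul, norm_circleVec, mul_one, norm_of_nonneg hr.le]
    simp only [hn, hk]
    by_cases hrR : r ≤ R
    · rw [Set.indicator_of_mem (show r ∈ Set.Ioc 0 R from ⟨hr, hrR⟩)]
      ring
    · rw [hfR _ (by rw [hn]; exact lt_of_not_ge hrR)]
      simp
  rw [h1, Measure.volume_eq_prod, ← Measure.prod_restrict, integral_prod]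
  · have h2 : ∀ r : ℝ, ∫ θ in Set.Ioo (-π) π, k r * f (r • circleVec θ) =
        (Set.Ioc 0 R).indicator (fun r => r * h r * circleInt f r) r := by
      intro r
      have h3 : ∫ θ in Set.Ioo (-π) π, f (r • circleVec θ) = circleInt f r := by
        rw [circleInt, intervalIntegral.integral_of_le (by linarith [pi_pos]),
          integral_Ioc_eq_integral_Ioo]
      rw [integral_const_mul, h3, hk]
      by_cases hr : r ∈ Set.Ioc 0 R <;> simp [hr]
    simp only [h2]
    rw [setIntegral_indicator measurableSet_Ioc, intervalIntegral.integral_of_le hR,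
      Set.inter_eq_self_of_subset_right Set.Ioc_subset_Ioi_self]
  · refine (hki.comp_fst _).mul_bdd (c := C) ?_ ?_
    · exact (by fun_prop : Continuous fun p : ℝ × ℝ => f (p.1 • circleVec p.2)).aestronglyMeasurable
    · exact Eventually.of_forall fun p => hC _

/-- A radial function `u(‖x‖)` with `r u'(r) = -c m(r)` and `m'(r) = 2π r f(r)` is a weak solution
of `-Δu = 2πc f(‖x‖)`. -/
lemma isWeakSol_of_radial {c : ℝ} {u m f : ℝ → ℝ} (hu : ContinuousOn u (Set.Ici 0))
    (hm : ContinuousOn m (Set.Ici 0)) (hm0 : m 0 = 0)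
    (hf : ∀ R, 0 < R → IntegrableOn (fun r => r * f r) (Set.Ioc 0 R))
    (hu' : ∀ r, 0 < r → HasDerivAt u (-(c * m r) / r) r)
    (hm' : ∀ r, 0 < r → HasDerivAt m (2 * π * (r * f r)) r) :
    IsWeakSol (fun x => u ‖x‖) (fun x => 2 * π * c * f ‖x‖) := by
  intro φ hφ hc
  have hφ2 : ContDiff ℝ 2 φ := hφ.of_le (WithTop.coe_le_coe.2 le_top)
  obtain ⟨R, hR0, hR⟩ : ∃ R : ℝ, 0 < R ∧ ∀ x, R ≤ ‖x‖ → x ∉ tsupport φ := by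
    obtain ⟨R, hR⟩ := hc.isCompact.isBounded.subset_closedBall (0 : R2)
    refine ⟨max R 0 + 1, by positivity, fun x hx hx' => ?_⟩
    have := hR hx'
    rw [mem_closedBall_zero_iff] at this
    linarith [le_max_left R 0]
  have hru : ContinuousOn (fun r => r * u r) (Set.Icc 0 R) :=
    continuousOn_id.mul (hu.mono Set.Icc_subset_Ici_self)
  have hui : IntegrableOn (fun r => r * u r) (Set.Ioc 0 R) :=
    hru.integrableOn_Icc.mono_set Set.Ioc_subset_Icc_self
  have hlc := continuous_lap hφ2
  have hΦ := continuous_circleInt hφ2.continuous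
  have hL := continuous_circleInt hlc
  rw [integral_radial_mul hR0.le hlc
    (fun x hx => lap_eq_zero_of_notMem_tsupport (hR x hx.le)) hui]
  have e1 : ∀ x : R2, 2 * π * c * f ‖x‖ * φ x = 2 * π * c * (f ‖x‖ * φ x) := fun x => by ring
  simp only [e1]
  rw [integral_const_mul, integral_radial_mul hR0.le hφ2.continuous
    (fun x hx => image_eq_zero_of_notMem_tsupport (hR x hx.le)) (hf R hR0),
    ← add_eq_zero_iff_eq_neg, ← intervalIntegral.integral_const_mul]
  have i1 : IntervalIntegrable (fun r => r * u r * circleInt (lap φ) r) volume 0 R :=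
    ContinuousOn.intervalIntegrable (by
      rw [Set.uIcc_of_le hR0.le]; exact hru.mul hL.continuousOn)
  have i2 : IntervalIntegrable (fun r => 2 * π * c * (r * f r * circleInt φ r)) volume 0 R := by
    refine IntervalIntegrable.const_mul ?_ _
    exact ((intervalIntegrable_iff_integrableOn_Ioc_of_le hR0.le).2 (hf R hR0)).mul_continuousOn
      hΦ.continuousOn
  rw [← intervalIntegral.integral_add i1 i2]
  have hB : Continuous fun r => r * circleRadial φ r :=
    continuous_iff_continuousAt.2 fun r => (hasDerivAt_mul_circleRadial hφ2 r).continuousAt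
  have key := intervalIntegral.integral_eq_sub_of_hasDerivAt_of_le hR0.le
    (f := fun r => u r * (r * circleRadial φ r) + c * (m r * circleInt φ r))
    (f' := fun r => r * u r * circleInt (lap φ) r + 2 * π * c * (r * f r * circleInt φ r))
    (by
      have h1 := hu.mono (Set.Icc_subset_Ici_self (a := R) (b := (0 : ℝ)))
      have h2 := hm.mono (Set.Icc_subset_Ici_self (a := R) (b := (0 : ℝ)))
      exact (h1.mul hB.continuousOn).add (continuousOn_const.mul (h2.mul hΦ.continuousOn)))
    (by
      intro r hr
      have hr0 : 0 < r := hr.1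
      refine (((hu' r hr0).mul (hasDerivAt_mul_circleRadial hφ2 r)).add
        (((hm' r hr0).mul (hasDerivAt_circleInt (hφ2.of_le one_le_two) hc r)).const_mul
          c)).congr_deriv ?_
      field_simp
      ring) (i1.add i2)
  rw [key]
  have hφR : ∀ θ, R • circleVec θ ∉ tsupport φ := fun θ => hR _ (by
    rw [norm_smul, norm_circleVec, mul_one, norm_of_nonneg hR0.le])
  have z1 : circleInt φ R = 0 := by
    simp [circleInt, fun θ => image_eq_zero_of_notMem_tsupport (hφR θ)]
  have z2 : circleRadial φ R = 0 := by
    simp [circleRadial, fun θ => fderiv_of_notMem_tsupport (𝕜 := ℝ) (hφR θ)]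
  simp [z1, z2, hm0]

section MeanField

open scoped InnerProductSpace

variable {H X : Type*} [NormedAddCommGroup H] [InnerProductSpace ℝ H] [CompleteSpace H]
  [TopologicalSpace.SeparableSpace H] [MeasurableSpace X]

lemma exists_subseq_tendsto_inner {M : ℝ} (g : ℕ → H) (hg : ∀ n, ‖g n‖ ≤ M) :
    ∃ (a : H) (φ : ℕ → ℕ), StrictMono φ ∧
      ∀ h, Tendsto (fun n => ⟪h, g (φ n)⟫_ℝ) atTop (nhds ⟪h, a⟫_ℝ) := by
  have hc := WeakDual.isSeqCompact_closedBall (𝕜 := ℝ) (E := H) 0 M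
  obtain ⟨a, -, φ, hφ, ha⟩ := hc
    (x := fun n => StrongDual.toWeakDual (InnerProductSpace.toDual ℝ H (g n))) (fun n => by
      simpa using hg n)
  refine ⟨(InnerProductSpace.toDual ℝ H).symm (WeakDual.toStrongDual a), φ, hφ, fun h => ?_⟩
  have h1 := ((WeakDual.eval_continuous h).tendsto a).comp ha
  convert h1 using 2
  · simp [real_inner_comm]
  · rw [real_inner_comm, InnerProductSpace.toDual_symm_apply]
    rfl

lemma exists_meanField {ν : Measure X} (hν : ν ≠ 0) {k : X → H} (hk : StronglyMeasurable k)
    {Θ θ : ℝ → ℝ} (hΘ : ∀ w, HasDerivAt Θ (θ w) w) (hθ : Continuous θ) (hpos : ∀ w, 0 < Θ w)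
    (hdom : ∀ M, ∃ B : X → ℝ, Integrable B ν ∧
      ∀ x w, |w| ≤ M * ‖k x‖ → |Θ w| ≤ B x ∧ |θ w| ≤ B x)
    (b : ℝ) (hcoer : ∃ ε C : ℝ, 0 < ε ∧
      ∀ g : H, ε * ‖g‖ ^ 2 - C ≤ 1 / 2 * ‖g‖ ^ 2 - b * log (∫ x, Θ ⟪k x, g⟫_ℝ ∂ν)) :
    ∃ g : H, 0 < ∫ x, Θ ⟪k x, g⟫_ℝ ∂ν ∧ ∀ h : H, (∃ D, ∀ x, |⟪k x, h⟫_ℝ| ≤ D) →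
      ⟪g, h⟫_ℝ = b / (∫ x, Θ ⟪k x, g⟫_ℝ ∂ν) * ∫ x, θ ⟪k x, g⟫_ℝ * ⟪k x, h⟫_ℝ ∂ν := by
  set Z : H → ℝ := fun g => ∫ x, Θ ⟪k x, g⟫_ℝ ∂ν with hZ
  set J : H → ℝ := fun g => 1 / 2 * ‖g‖ ^ 2 - b * log (Z g) with hJ
  have hΘc : Continuous Θ := continuous_iff_continuousAt.2 fun w => (hΘ w).continuousAt
  have hm (g : H) : StronglyMeasurable fun x => ⟪k x, g⟫_ℝ := hk.inner stronglyMeasurable_const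
  have hmΘ (g : H) : AEStronglyMeasurable (fun x => Θ ⟪k x, g⟫_ℝ) ν :=
    (hΘc.comp_stronglyMeasurable (hm g)).aestronglyMeasurable
  have hmθ (g : H) : AEStronglyMeasurable (fun x => θ ⟪k x, g⟫_ℝ) ν :=
    (hθ.comp_stronglyMeasurable (hm g)).aestronglyMeasurable
  have hle {g : H} {M : ℝ} (hg : ‖g‖ ≤ M) (x : X) : |⟪k x, g⟫_ℝ| ≤ M * ‖k x‖ := by
    refine (abs_real_inner_le_norm _ _).trans ?_
    rw [mul_comm]
    gcongr
  have hI (g : H) : Integrable (fun x => Θ ⟪k x, g⟫_ℝ) ν := by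
    obtain ⟨B, hB, hB'⟩ := hdom ‖g‖
    exact hB.mono' (hmΘ g) (Eventually.of_forall fun x => (hB' x _ (hle le_rfl x)).1)
  have hZpos (g : H) : 0 < Z g := by
    rw [hZ]
    refine (integral_pos_iff_support_of_nonneg (fun x => (hpos _).le) (hI g)).2 ?_
    have : Function.support (fun x => Θ ⟪k x, g⟫_ℝ) = Set.univ :=
      Set.eq_univ_of_forall fun x => (hpos _).ne'
    rw [this]
    exact Measure.measure_univ_pos.2 hν
  obtain ⟨ε, C, hε, hcoer⟩ := hcoer
  have hbdd : BddBelow (Set.range J) := ⟨-C, by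
    rintro _ ⟨g, rfl⟩
    have := hcoer g
    have : 0 ≤ ε * ‖g‖ ^ 2 := by positivity
    simp only [hJ, hZ]
    linarith⟩
  have hseq : ∀ n : ℕ, ∃ g, J g < sInf (Set.range J) + 1 / ((n : ℝ) + 1) := by
    intro n
    obtain ⟨_, ⟨g, rfl⟩, hg⟩ := exists_lt_of_csInf_lt (Set.range_nonempty J)
      (lt_add_of_pos_right (sInf (Set.range J)) (show (0 : ℝ) < 1 / ((n : ℝ) + 1) by positivity))
    exact ⟨g, hg⟩
  choose g hg using hseq
  have hgb : ∃ M, ∀ n, ‖g n‖ ≤ M := by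
    refine ⟨√((sInf (Set.range J) + 1 + C) / ε), fun n => ?_⟩
    refine Real.le_sqrt_of_sq_le ?_
    rw [le_div_iff₀ hε]
    have h1 := hcoer (g n)
    have h2 := hg n
    have h3 : 1 / ((n : ℝ) + 1) ≤ 1 := by
      rw [div_le_one (by positivity)]
      linarith [n.cast_nonneg (α := ℝ)]
    simp only [hJ, hZ] at h2 ⊢
    linarith
  obtain ⟨M, hM⟩ := hgb
  obtain ⟨a, φ, hφ, ha⟩ := exists_subseq_tendsto_inner g hM
  have hZlim : Tendsto (fun n => Z (g (φ n))) atTop (nhds (Z a)) := by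
    obtain ⟨B, hB, hB'⟩ := hdom M
    refine tendsto_integral_of_dominated_convergence B (fun n => hmΘ _) hB
      (fun n => Eventually.of_forall fun x => (hB' x _ (hle (hM _) x)).1)
      (Eventually.of_forall fun x => ?_)
    exact (hΘc.tendsto _).comp (ha (k x))
  have hmin : ∀ h, J a ≤ J h := by
    intro h
    refine le_trans ?_ (csInf_le hbdd ⟨h, rfl⟩)
    have l1 : Tendsto (fun n => ⟪a, g (φ n)⟫_ℝ - 1 / 2 * ‖a‖ ^ 2 - b * log (Z (g (φ n)))) atTop
        (nhds (⟪a, a⟫_ℝ - 1 / 2 * ‖a‖ ^ 2 - b * log (Z a))) :=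
      ((ha a).sub_const _).sub ((hZlim.log (hZpos a).ne').const_mul b)
    have l2 : Tendsto (fun n => sInf (Set.range J) + 1 / ((φ n : ℝ) + 1)) atTop
        (nhds (sInf (Set.range J) + 0)) :=
      (tendsto_one_div_add_atTop_nhds_zero_nat.comp hφ.tendsto_atTop).const_add _
    have l3 := le_of_tendsto_of_tendsto' l1 l2 fun n => by
      refine le_trans ?_ (hg (φ n)).le
      have h1 := norm_sub_sq_real a (g (φ n))
      have h2 : 0 ≤ ‖a - g (φ n)‖ ^ 2 := by positivity
      simp only [hJ]
      linarith
    rw [add_zero, real_inner_self_eq_norm_sq] at l3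
    simp only [hJ]
    linarith
  refine ⟨a, hZpos a, fun h ⟨D, hD⟩ => ?_⟩
  have hderiv : HasDerivAt (fun t : ℝ => Z (a + t • h)) (∫ x, θ ⟪k x, a⟫_ℝ * ⟪k x, h⟫_ℝ ∂ν) 0 := by
    obtain ⟨B, hB, hB'⟩ := hdom (‖a‖ + ‖h‖)
    have hdd (x : X) (t : ℝ) : HasDerivAt (fun t : ℝ => Θ ⟪k x, a + t • h⟫_ℝ)
        (θ ⟪k x, a + t • h⟫_ℝ * ⟪k x, h⟫_ℝ) t := by
      refine (hΘ _).comp t ?_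
      simp only [inner_add_right, real_inner_smul_right]
      simpa using ((hasDerivAt_id t).mul_const ⟪k x, h⟫_ℝ).const_add ⟪k x, a⟫_ℝ
    have := (hasDerivAt_integral_of_dominated_loc_of_deriv_le (μ := ν) (x₀ := (0 : ℝ))
      (F := fun t x => Θ ⟪k x, a + t • h⟫_ℝ)
      (F' := fun t x => θ ⟪k x, a + t • h⟫_ℝ * ⟪k x, h⟫_ℝ) (bound := fun x => B x * D)
      (Metric.ball_mem_nhds 0 one_pos) (Eventually.of_forall fun t => hmΘ _) (hI _)
      ((hmθ _).mul (hm h).aestronglyMeasurable) ?_ (hB.mul_const D)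
      (Eventually.of_forall fun x t _ => hdd x t)).2
    · simpa using this
    · refine Eventually.of_forall fun x t ht => ?_
      rw [norm_mul, norm_eq_abs, norm_eq_abs]
      have h1 : ‖a + t • h‖ ≤ ‖a‖ + ‖h‖ := by
        refine (norm_add_le _ _).trans ?_
        rw [norm_smul]
        have : ‖t‖ ≤ 1 := by simpa using (mem_ball_zero_iff.1 ht).le
        gcongr
        exact mul_le_of_le_one_left (norm_nonneg _) this
      have h2 := (hB' x _ (hle h1 x)).2
      have := (abs_nonneg _).trans h2
      gcongr
      exact hD x
  have hderivJ : HasDerivAt (fun t : ℝ => J (a + t • h))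
      (⟪a, h⟫_ℝ - b * ((∫ x, θ ⟪k x, a⟫_ℝ * ⟪k x, h⟫_ℝ ∂ν) / Z a)) 0 := by
    have h1 : HasDerivAt (fun t : ℝ => 1 / 2 * ‖a + t • h‖ ^ 2) ⟪a, h⟫_ℝ 0 := by
      have h2 : HasDerivAt (fun t : ℝ => a + t • h) h 0 := by
        simpa using ((hasDerivAt_id (0 : ℝ)).smul_const h).const_add a
      have := h2.norm_sq.const_mul (1 / 2)
      simpa using this
    have h3 := (hderiv.log (by simpa using (hZpos a).ne')).const_mul b
    have h4 := h1.sub h3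
    simp only [zero_smul, add_zero] at h4
    exact h4
  have hzero := IsLocalMin.hasDerivAt_eq_zero
    (Eventually.of_forall fun t => by simpa using hmin (a + t • h)) hderivJ
  rw [sub_eq_zero.1 hzero]
  ring

end MeanField

section Kernel

open scoped InnerProductSpace

/-- The reproducing kernel `G(s, t) = |[0, s] ∩ [0, t]|` of the Dirichlet form on functions
vanishing at the origin of `ℝ`. -/
def dirichletKernel (s t : ℝ) : ℝ := volume.real (Set.uIoc 0 s ∩ Set.uIoc 0 t)

/-- Indicator function of the segment between `0` and `s`, as an element of `L²(ℝ)`. -/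
def segmentVec (s : ℝ) : Lp ℝ 2 (volume : Measure ℝ) :=
  indicatorConstLp 2 (s := Set.uIoc 0 s) measurableSet_uIoc (by simp [Set.uIoc]) 1

lemma inner_segmentVec (s t : ℝ) : ⟪segmentVec s, segmentVec t⟫_ℝ = dirichletKernel s t :=
  L2.real_inner_indicatorConstLp_one_indicatorConstLp_one _ _ _ _

lemma dirichletKernel_nonneg (s t : ℝ) : 0 ≤ dirichletKernel s t := measureReal_nonneg

lemma dirichletKernel_eq (s t : ℝ) :
    dirichletKernel s t = max s 0 - max (s - t) 0 + max (-t) 0 := by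
  have h (a b c d : ℝ) : volume.real (Set.Ioc a b ∩ Set.Ioc c d) =
      max (min b d - max a c) 0 := by
    rw [Set.Ioc_inter_Ioc, Measure.real, Real.volume_Ioc, ENNReal.toReal_ofReal']
  rw [dirichletKernel, Set.uIoc, Set.uIoc, h]
  grind

lemma dirichletKernel_self (s : ℝ) : dirichletKernel s s = |s| := by
  rw [dirichletKernel_eq]
  grind

lemma dirichletKernel_comm (s t : ℝ) : dirichletKernel s t = dirichletKernel t s := by
  rw [dirichletKernel, Set.inter_comm, dirichletKernel]

lemma norm_segmentVec (s : ℝ) : ‖segmentVec s‖ = √|s| := by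
  rw [@norm_eq_sqrt_real_inner _ _ _, inner_segmentVec, dirichletKernel_self]

lemma abs_dirichletKernel_le (s t : ℝ) : |dirichletKernel s t| ≤ |t| := by
  rw [dirichletKernel_eq]
  grind

lemma continuous_segmentVec : Continuous segmentVec := by
  refine continuous_iff_continuousAt.2 fun s => ?_
  rw [ContinuousAt, tendsto_iff_norm_sub_tendsto_zero]
  have h (t : ℝ) : ‖segmentVec t - segmentVec s‖ = √|t - s| := by
    rw [← Real.sqrt_sq (norm_nonneg (segmentVec t - segmentVec s)), norm_sub_sq_real,
      inner_segmentVec, norm_segmentVec, norm_segmentVec, Real.sq_sqrt (abs_nonneg _),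
      Real.sq_sqrt (abs_nonneg _), dirichletKernel_eq]
    congr 1
    grind
  simp only [h]
  have : Continuous fun t => √|t - s| := by fun_prop
  simpa using this.tendsto s

instance : TopologicalSpace.SeparableSpace (Lp ℝ 2 (volume : Measure ℝ)) := by
  have : Fact ((2 : ENNReal) ≠ ⊤) := ⟨by simp⟩
  infer_instance

end Kernel

section LogarithmicMeanField

open scoped InnerProductSpace

variable {X : Type*} [MeasurableSpace X] {ν : Measure X} {ℓ : X → ℝ} {b : ℝ}

lemma exists_logMeanField {Θ θ : ℝ → ℝ} (hν : ν ≠ 0) (hℓ : Measurable ℓ)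
    (hΘ : ∀ w, HasDerivAt Θ (θ w) w) (hθ : Continuous θ) (hpos : ∀ w, 0 < Θ w)
    (hdom : ∀ M, ∃ B : X → ℝ, Integrable B ν ∧
      ∀ x w, |w| ≤ M * √|ℓ x| → |Θ w| ≤ B x ∧ |θ w| ≤ B x)
    (hcoer : ∃ ε C : ℝ, 0 < ε ∧ ∀ (G : ℝ) (w : ℝ → ℝ), Measurable w → (∀ s, |w s| ≤ G * √|s|) →
      ε * G ^ 2 - C ≤ 1 / 2 * G ^ 2 - b * log (∫ x, Θ (w (ℓ x)) ∂ν)) :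
    ∃ (w : ℝ → ℝ) (C : ℝ), Continuous w ∧ (∀ s, |w s| ≤ C * √|s|) ∧
      0 < ∫ x, Θ (w (ℓ x)) ∂ν ∧
      ∀ s, w s = b / (∫ x, Θ (w (ℓ x)) ∂ν) * ∫ x, θ (w (ℓ x)) * dirichletKernel s (ℓ x) ∂ν := by
  have hw (g : Lp ℝ 2 (volume : Measure ℝ)) (s : ℝ) : |⟪segmentVec s, g⟫_ℝ| ≤ ‖g‖ * √|s| := by
    rw [← norm_segmentVec, mul_comm]
    exact abs_real_inner_le_norm _ _
  have hc (g : Lp ℝ 2 (volume : Measure ℝ)) : Continuous fun s => ⟪segmentVec s, g⟫_ℝ :=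
    continuous_segmentVec.inner continuous_const
  obtain ⟨ε, C, hε, hcoer⟩ := hcoer
  obtain ⟨g, hg, hg'⟩ := exists_meanField (H := Lp ℝ 2 (volume : Measure ℝ)) hν
    (k := fun x => segmentVec (ℓ x)) (continuous_segmentVec.stronglyMeasurable.comp_measurable hℓ)
    hΘ hθ hpos (by simpa only [norm_segmentVec] using hdom) b
    ⟨ε, C, hε, fun g => hcoer ‖g‖ _ (hc g).measurable (hw g)⟩
  refine ⟨fun s => ⟪segmentVec s, g⟫_ℝ, ‖g‖, hc g, hw g, hg, fun s => ?_⟩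
  have h := hg' (segmentVec s)
    ⟨|s|, fun x => by rw [inner_segmentVec]; exact abs_dirichletKernel_le _ _⟩
  rw [real_inner_comm] at h
  simpa only [inner_segmentVec, dirichletKernel_comm _ s] using h

lemma exp_le_of_abs_le_mul_sqrt {x C s c : ℝ} (hc : 0 < c) (hx : |x| ≤ C * √|s|) :
    exp x ≤ exp (C ^ 2 / (4 * c)) * exp (c * |s|) := by
  rw [← exp_add]
  refine exp_le_exp.2 ((le_abs_self x).trans (hx.trans ?_))
  have h1 := Real.sq_sqrt (abs_nonneg s)
  have h2 : C ^ 2 / (4 * c) + c * |s| - C * √|s| = (C - 2 * c * √|s|) ^ 2 / (4 * c) := by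
    field_simp
    linear_combination 4 * c ^ 2 * (-h1)
  have h3 : 0 ≤ (C - 2 * c * √|s|) ^ 2 / (4 * c) := by positivity
  linarith

lemma exists_expMeanField_of_pos (hν : ν ≠ 0) (hℓ : Measurable ℓ) (hb : 0 < b) {c : ℝ}
    (hc : b / 2 < c) (hI : Integrable (fun x => exp (c * |ℓ x|)) ν) :
    ∃ (w : ℝ → ℝ) (C : ℝ), Continuous w ∧ (∀ s, |w s| ≤ C * √|s|) ∧
      0 < ∫ x, exp (w (ℓ x)) ∂ν ∧ ∀ s, w s =
        b / (∫ x, exp (w (ℓ x)) ∂ν) * ∫ x, exp (w (ℓ x)) * dirichletKernel s (ℓ x) ∂ν := by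
  have hc0 : 0 < c := by linarith
  have hle {M w s : ℝ} (hw : |w| ≤ M * √|s|) : exp w ≤ exp (M ^ 2 / (4 * c)) * exp (c * |s|) :=
    exp_le_of_abs_le_mul_sqrt hc0 hw
  refine exists_logMeanField hν hℓ (fun w => hasDerivAt_exp w) continuous_exp exp_pos
    (fun M => ⟨_, hI.const_mul (exp (M ^ 2 / (4 * c))), fun x w hw => ?_⟩)
    ⟨1 / 2 - b / (4 * c), b * log (∫ x, exp (c * |ℓ x|) ∂ν), ?_, fun G w hwm hw => ?_⟩
  · rw [abs_exp]
    exact ⟨hle hw, hle hw⟩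
  · rw [sub_pos, div_lt_div_iff₀ (by positivity) (by positivity)]
    linarith
  · have : NeZero ν := ⟨hν⟩
    have h1 : ∫ x, exp (w (ℓ x)) ∂ν ≤ exp (G ^ 2 / (4 * c)) * ∫ x, exp (c * |ℓ x|) ∂ν := by
      rw [← integral_const_mul]
      exact integral_mono_of_nonneg (Eventually.of_forall fun x => (exp_pos _).le)
        (hI.const_mul _) (Eventually.of_forall fun x => hle (hw _))
    have h2 : 0 < ∫ x, exp (w (ℓ x)) ∂ν := by
      refine integral_exp_pos ?_
      refine (hI.const_mul (exp (G ^ 2 / (4 * c)))).mono'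
        (by exact (measurable_exp.comp (hwm.comp hℓ)).aestronglyMeasurable)
        (Eventually.of_forall fun x => ?_)
      rw [norm_eq_abs, abs_exp]
      exact hle (hw _)
    have h3 := log_le_log h2 h1
    rw [log_mul (exp_pos _).ne' (integral_exp_pos hI).ne', log_exp] at h3
    have h4 := mul_le_mul_of_nonneg_left h3 hb.le
    have h5 : b * (G ^ 2 / (4 * c)) = b / (4 * c) * G ^ 2 := by ring
    linarith

lemma hasDerivAt_exp_min_sub_exp_neg_max (w : ℝ) :
    HasDerivAt (fun w => exp (min w 0) + 1 - exp (-max w 0)) (exp (-|w|)) w := by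
  have hl (w : ℝ) : HasDerivAt (fun w => exp w + 1 - exp (-0)) (exp w) w := by
    simpa using ((hasDerivAt_exp w).add_const 1).sub_const (exp (-0))
  have hr (w : ℝ) : HasDerivAt (fun w => exp 0 + 1 - exp (-w)) (exp (-w)) w := by
    simpa using (hasDerivAt_neg w).exp.const_sub (exp 0 + 1)
  rcases lt_trichotomy w 0 with h | rfl | h
  · rw [abs_of_neg h, neg_neg]
    refine (hl w).congr_of_eventuallyEq ?_
    filter_upwards [Iio_mem_nhds h] with t ht
    rw [min_eq_left (le_of_lt ht), max_eq_right (le_of_lt ht)]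
  · rw [← hasDerivWithinAt_univ, ← Set.Iic_union_Ici (a := (0 : ℝ))]
    refine HasDerivWithinAt.union ?_ ?_
    · simp only [abs_zero, neg_zero]
      refine (hl 0).hasDerivWithinAt.congr (fun t ht => ?_) (by simp)
      rw [min_eq_left ht, max_eq_right ht]
    · rw [abs_zero]
      refine (hr 0).hasDerivWithinAt.congr (fun t ht => ?_) (by simp)
      rw [min_eq_right ht, max_eq_left ht]
  · rw [abs_of_pos h]
    refine (hr w).congr_of_eventuallyEq ?_
    filter_upwards [Ioi_mem_nhds h] with t ht
    rw [min_eq_right (le_of_lt ht), max_eq_left (le_of_lt ht)]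

lemma exists_expMeanField_of_neg [IsFiniteMeasure ν] (hν : ν ≠ 0) (hℓ : Measurable ℓ)
    (hb : b < 0) :
    ∃ (w : ℝ → ℝ) (C : ℝ), Continuous w ∧ (∀ s, |w s| ≤ C * √|s|) ∧
      0 < ∫ x, exp (w (ℓ x)) ∂ν ∧ ∀ s, w s =
        b / (∫ x, exp (w (ℓ x)) ∂ν) * ∫ x, exp (w (ℓ x)) * dirichletKernel s (ℓ x) ∂ν := by
  set Θ : ℝ → ℝ := fun w => exp (min w 0) + 1 - exp (-max w 0) with hΘ
  have hΘm : Measurable Θ := by fun_prop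
  have hlow (w : ℝ) : exp (-|w|) ≤ Θ w := by
    rcases le_total w 0 with h | h
    · simp [hΘ, h, abs_of_nonpos]
    · have : exp (-w) ≤ 1 := exp_le_one_iff.2 (by linarith)
      simp only [hΘ, h, abs_of_nonneg, min_eq_right, max_eq_left, exp_zero]
      linarith
  have hup (w : ℝ) : Θ w ≤ 2 := by
    have h1 : exp (min w 0) ≤ 1 := exp_le_one_iff.2 (min_le_right _ _)
    have h2 := exp_pos (-max w 0)
    simp only [hΘ]
    linarith
  have habs (w : ℝ) : |Θ w| ≤ 2 := by
    rw [abs_of_pos ((exp_pos _).trans_le (hlow w))]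
    exact hup w
  obtain ⟨N, hN⟩ : ∃ N : ℕ, 0 < ν.real {x | |ℓ x| ≤ N} := by
    by_contra! h
    refine hν (Measure.measure_univ_eq_zero.1 ?_)
    have : (Set.univ : Set X) = ⋃ N : ℕ, {x | |ℓ x| ≤ N} := by
      ext x
      simpa using exists_nat_ge |ℓ x|
    rw [this]
    refine measure_iUnion_null fun N => ?_
    exact (measureReal_eq_zero_iff).1 (le_antisymm (h N) measureReal_nonneg)
  set S : Set X := {x | |ℓ x| ≤ N} with hS
  have hSm : MeasurableSet S := measurableSet_le hℓ.abs measurable_const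
  have hcoer (G : ℝ) (w : ℝ → ℝ) (hwm : Measurable w) (hw : ∀ s, |w s| ≤ G * √|s|) :
      1 / 4 * G ^ 2 - (b ^ 2 * N + b * log (ν.real S)) ≤
        1 / 2 * G ^ 2 - b * log (∫ x, Θ (w (ℓ x)) ∂ν) := by
    have hI : Integrable (fun x => Θ (w (ℓ x))) ν :=
      Integrable.of_bound (hΘm.comp (hwm.comp hℓ)).aestronglyMeasurable 2
        (Eventually.of_forall fun x => habs _)
    have hG : 0 ≤ G := by simpa using (abs_nonneg _).trans (hw 1)
    have h1 : exp (-(G * √N)) * ν.real S ≤ ∫ x, Θ (w (ℓ x)) ∂ν := by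
      calc exp (-(G * √N)) * ν.real S = ∫ x in S, exp (-(G * √N)) ∂ν := by
            rw [setIntegral_const, smul_eq_mul, mul_comm]
        _ ≤ ∫ x in S, Θ (w (ℓ x)) ∂ν := by
            refine setIntegral_mono_on (integrable_const _).integrableOn hI.integrableOn hSm
              fun x hx => le_trans (exp_le_exp.2 (neg_le_neg ?_)) (hlow _)
            exact (hw _).trans (mul_le_mul_of_nonneg_left (sqrt_le_sqrt hx) hG)
        _ ≤ ∫ x, Θ (w (ℓ x)) ∂ν := setIntegral_le_integral hI
            (Eventually.of_forall fun x => (exp_pos _).le.trans (hlow _))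
    have h2 := log_le_log (by positivity) h1
    rw [log_mul (exp_pos _).ne' hN.ne', log_exp] at h2
    have h3 := mul_le_mul_of_nonpos_left h2 hb.le
    have h4 := Real.sq_sqrt (Nat.cast_nonneg (α := ℝ) N)
    have h5 : 0 ≤ (G / 2 + b * √N) ^ 2 := sq_nonneg _
    nlinarith
  obtain ⟨w, C, hw, hC, hZ, h⟩ := exists_logMeanField (Θ := Θ) (b := b) hν hℓ
    hasDerivAt_exp_min_sub_exp_neg_max (by fun_prop) (fun w => (exp_pos _).trans_le (hlow w))
    (fun M => ⟨fun _ => 2, integrable_const _, fun x w _ =>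
      ⟨habs w, by rw [abs_exp]; exact (hlow w).trans (hup w)⟩⟩)
    ⟨1 / 4, b ^ 2 * N + b * log (ν.real S), by norm_num, hcoer⟩
  have hneg (s : ℝ) : w s ≤ 0 := by
    rw [h s]
    exact mul_nonpos_of_nonpos_of_nonneg (div_nonpos_of_nonpos_of_nonneg hb.le hZ.le)
      (integral_nonneg fun x => mul_nonneg (exp_pos _).le (dirichletKernel_nonneg _ _))
  have h1 (s : ℝ) : Θ (w s) = exp (w s) := by simp [hΘ, hneg s]
  have h2 (s : ℝ) : exp (-|w s|) = exp (w s) := by rw [abs_of_nonpos (hneg s), neg_neg]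
  simp only [h1, h2] at hZ h
  exact ⟨w, C, hw, hC, hZ, h⟩

end LogarithmicMeanField

section LogPotential

lemma log_one_add_le_rpow_div {x α : ℝ} (hx : 0 ≤ x) (hα : 0 < α) (hα1 : α ≤ 1) :
    log (1 + x) ≤ x ^ α / α := by
  have h1 : log ((1 + x) ^ α) ≤ x ^ α := by
    have h2 := Real.rpow_add_le_add_rpow zero_le_one hx hα.le hα1
    have h3 := log_le_sub_one_of_pos (rpow_pos_of_pos (by linarith : 0 < 1 + x) α)
    rw [one_rpow] at h2
    linarith
  rw [log_rpow (by linarith)] at h1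
  rwa [le_div_iff₀ hα, mul_comm]

lemma abs_posLog_div_sub_le {r s ρ α : ℝ} (hr : 0 ≤ r) (hs : 0 ≤ s) (hρ : 0 < ρ) (hα : 0 < α)
    (hα1 : α ≤ 1) : |log⁺ (r / ρ) - log⁺ (s / ρ)| ≤ |r - s| ^ α / α * ρ ^ (-α) := by
  wlog h : s ≤ r generalizing r s
  · rw [abs_sub_comm, abs_sub_comm r s]
    exact this hs hr (le_of_not_ge h)
  have h0 : log⁺ (s / ρ) ≤ log⁺ (r / ρ) := posLog_le_posLog (by positivity) (by gcongr)
  have h1 : 0 ≤ (r - s) / ρ := div_nonneg (sub_nonneg.2 h) hρ.le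
  have h2 : log⁺ (r / ρ) ≤ log⁺ (s / ρ) + log (1 + (r - s) / ρ) := by
    rw [posLog_eq_log_max_one (by positivity), posLog_eq_log_max_one (by positivity),
      ← log_mul (by positivity) (by positivity)]
    refine log_le_log (by positivity) (max_le ?_ ?_)
    · nlinarith [le_max_left 1 (s / ρ)]
    · have h3 : r / ρ = s / ρ + (r - s) / ρ := by ring
      nlinarith [le_max_left 1 (s / ρ), le_max_right 1 (s / ρ)]
  have h3 := log_one_add_le_rpow_div h1 hα hα1
  rw [abs_of_nonneg (sub_nonneg.2 h0), abs_of_nonneg (sub_nonneg.2 h)]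
  rw [div_rpow (sub_nonneg.2 h) hρ.le] at h3
  rw [rpow_neg hρ.le]
  calc _ ≤ (r - s) ^ α / ρ ^ α / α := by linarith
    _ = _ := by ring

lemma posLog_div_eq {r ρ : ℝ} (hr : 0 < r) (hρ : 0 < ρ) :
    log⁺ (r / ρ) = max (log r - log ρ) 0 := by
  rw [posLog_apply, log_div hr.ne' hρ.ne', max_comm]

/-- The radial logarithmic potential `r ↦ ∫ log⁺ (r / ρ) dμ(ρ)` of a measure on `(0, ∞)`. -/
def logPotential (μ : Measure ℝ) (r : ℝ) : ℝ := ∫ ρ, log⁺ (r / ρ) ∂μ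

variable {μ : Measure ℝ} {α : ℝ}

lemma integrable_posLog_div (hμ : ∀ᵐ ρ ∂μ, 0 < ρ) (hα : 0 < α) (hα1 : α ≤ 1)
    (hI : Integrable (fun ρ => ρ ^ (-α)) μ) {r : ℝ} (hr : 0 ≤ r) :
    Integrable (fun ρ => log⁺ (r / ρ)) μ := by
  refine (hI.const_mul (r ^ α / α)).mono'
    (Measurable.aestronglyMeasurable (by fun_prop)) ?_
  filter_upwards [hμ] with ρ hρ
  simpa [abs_of_nonneg hr] using abs_posLog_div_sub_le hr le_rfl hρ hα hα1

lemma abs_logPotential_sub_le (hμ : ∀ᵐ ρ ∂μ, 0 < ρ) (hα : 0 < α) (hα1 : α ≤ 1)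
    (hI : Integrable (fun ρ => ρ ^ (-α)) μ) {r s : ℝ} (hr : 0 ≤ r) (hs : 0 ≤ s) :
    |logPotential μ r - logPotential μ s| ≤ (∫ ρ, ρ ^ (-α) ∂μ) / α * |r - s| ^ α := by
  rw [logPotential, logPotential, ← integral_sub (integrable_posLog_div hμ hα hα1 hI hr)
    (integrable_posLog_div hμ hα hα1 hI hs)]
  calc |∫ ρ, (log⁺ (r / ρ) - log⁺ (s / ρ)) ∂μ| ≤ ∫ ρ, |r - s| ^ α / α * ρ ^ (-α) ∂μ := by
        rw [← norm_eq_abs]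
        refine norm_integral_le_of_norm_le (hI.const_mul _) ?_
        filter_upwards [hμ] with ρ hρ
        exact abs_posLog_div_sub_le hr hs hρ hα hα1
    _ = _ := by rw [integral_const_mul]; ring

lemma hasDerivAt_logPotential [IsFiniteMeasure μ] (hμ : ∀ᵐ ρ ∂μ, 0 < ρ) (hα : 0 < α) (hα1 : α ≤ 1)
    (hI : Integrable (fun ρ => ρ ^ (-α)) μ) {r : ℝ} (hr : 0 < r) (hμr : ∀ᵐ ρ ∂μ, ρ ≠ r) :
    HasDerivAt (logPotential μ) (μ.real (Set.Iio r) / r) r := by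
  have h := (hasDerivAt_integral_of_dominated_loc_of_lip (μ := μ) (x₀ := r)
    (F := fun t ρ => log⁺ (t / ρ)) (F' := (Set.Iio r).indicator fun _ => r⁻¹)
    (bound := fun _ => 2 / r) (s := Set.Ioi (r / 2)) (Ioi_mem_nhds (by linarith))
    (Eventually.of_forall fun t => Measurable.aestronglyMeasurable (by fun_prop))
    (integrable_posLog_div hμ hα hα1 hI hr.le)
    (measurable_const.indicator measurableSet_Iio).aestronglyMeasurable ?_ (integrable_const _)
    ?_).2
  · rw [integral_indicator_const _ measurableSet_Iio, smul_eq_mul, ← div_eq_mul_inv] at h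
    exact h
  · have key {t s : ℝ} (ht : r / 2 < t) (hs : r / 2 < s) : log t - log s ≤ 2 / r * |t - s| := by
      have ht0 : 0 < t := by linarith
      have hs0 : 0 < s := by linarith
      rw [← log_div ht0.ne' hs0.ne']
      refine (log_le_sub_one_of_pos (by positivity)).trans ?_
      calc t / s - 1 = (t - s) / s := by field_simp
        _ ≤ |t - s| / (r / 2) := by gcongr; exact le_abs_self _
        _ = _ := by field_simp
    filter_upwards [hμ] with ρ hρ
    refine LipschitzOnWith.of_dist_le_mul fun t ht s hs => ?_
    have ht0 : 0 < t := (half_pos hr).trans ht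
    have hs0 : 0 < s := (half_pos hr).trans hs
    rw [dist_eq, dist_eq, posLog_div_eq ht0 hρ, posLog_div_eq hs0 hρ, Real.coe_nnabs,
      abs_of_pos (by positivity : 0 < 2 / r)]
    refine (abs_max_sub_max_le_abs _ _ _).trans ?_
    rw [sub_sub_sub_cancel_right]
    refine abs_le.2 ⟨?_, key ht hs⟩
    have := key hs ht
    rw [abs_sub_comm] at this
    linarith
  · filter_upwards [hμ, hμr] with ρ hρ hne
    rcases hne.lt_or_gt with h | h
    · rw [Set.indicator_of_mem (Set.mem_Iio.2 h)]
      refine ((hasDerivAt_log hr.ne').sub_const (log ρ)).congr_of_eventuallyEq ?_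
      filter_upwards [Ioi_mem_nhds h] with t ht
      rw [posLog_div_eq (hρ.trans ht) hρ, max_eq_left]
      exact sub_nonneg.2 (log_le_log hρ (le_of_lt ht))
    · rw [Set.indicator_of_notMem (by simpa using h.le)]
      refine (hasDerivAt_const r (0 : ℝ)).congr_of_eventuallyEq ?_
      filter_upwards [Ioo_mem_nhds hr h] with t ht
      rw [posLog_div_eq ht.1 hρ, max_eq_right]
      exact sub_nonpos.2 (log_le_log ht.1 ht.2.le)

lemma tendsto_logPotential_div_log [IsProbabilityMeasure μ] (hμ : ∀ᵐ ρ ∂μ, 0 < ρ) (hα : 0 < α)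
    (hα1 : α ≤ 1) (hI : Integrable (fun ρ => ρ ^ (-α)) μ) :
    Tendsto (fun r => logPotential μ r / log r) atTop (nhds 1) := by
  have h : Tendsto (fun r => ∫ ρ, log⁺ (r / ρ) / log r ∂μ) atTop (nhds (∫ _, 1 ∂μ)) := by
    refine tendsto_integral_filter_of_dominated_convergence (fun ρ => 1 + log⁺ (1 / ρ))
      (Eventually.of_forall fun r => Measurable.aestronglyMeasurable (by fun_prop)) ?_
      ((integrable_const _).add (integrable_posLog_div hμ hα hα1 hI zero_le_one)) ?_
    · filter_upwards [eventually_ge_atTop (exp 1)] with r hr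
      have hr1 : 1 ≤ log r := by simpa using log_le_log (exp_pos 1) hr
      have hr0 : 0 < r := (exp_pos 1).trans_le hr
      filter_upwards with ρ
      rw [norm_div, norm_of_nonneg posLog_nonneg, norm_of_nonneg (by linarith),
        div_le_iff₀ (by linarith)]
      have h1 := posLog_mul (x := r) (y := 1 / ρ)
      rw [mul_one_div, posLog_apply (x := r), max_eq_right (by linarith)] at h1
      nlinarith [posLog_nonneg (x := 1 / ρ)]
    · filter_upwards [hμ] with ρ hρ
      have h1 : Tendsto (fun r => 1 - log ρ / log r) atTop (nhds (1 - 0)) :=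
        (tendsto_log_atTop.const_div_atTop _).const_sub 1
      rw [sub_zero] at h1
      refine h1.congr' ?_
      filter_upwards [eventually_gt_atTop ρ, eventually_gt_atTop 1] with r hr hr1
      rw [posLog_div_eq (hρ.trans hr) hρ, max_eq_left (sub_nonneg.2 (log_le_log hρ hr.le)),
        sub_div, div_self (log_pos hr1).ne']
  simpa [integral_div, logPotential] using h

end LogPotential

section RadialMeanField

/-- The measure on `(0, ∞)` with density `f`. -/
def densityMeasure (f : ℝ → ℝ) : Measure ℝ :=
  (volume.restrict (Set.Ioi 0)).withDensity fun r => ENNReal.ofReal (f r)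

variable {f : ℝ → ℝ}

lemma integral_densityMeasure (hf : Measurable f) (hf0 : ∀ r, 0 < r → 0 ≤ f r) (g : ℝ → ℝ) :
    ∫ r, g r ∂densityMeasure f = ∫ r in Set.Ioi 0, f r * g r := by
  rw [densityMeasure, integral_withDensity_eq_integral_toReal_smul (by fun_prop) (by simp)]
  refine setIntegral_congr_fun measurableSet_Ioi fun r hr => ?_
  simp [ENNReal.toReal_ofReal (hf0 r hr)]

lemma integrable_densityMeasure_iff (hf : Measurable f) (hf0 : ∀ r, 0 < r → 0 ≤ f r) {g : ℝ → ℝ} :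
    Integrable g (densityMeasure f) ↔ IntegrableOn (fun r => f r * g r) (Set.Ioi 0) := by
  rw [densityMeasure, integrable_withDensity_iff_integrable_smul' (by fun_prop) (by simp)]
  refine integrableOn_congr_fun (fun r hr => ?_) measurableSet_Ioi
  simp [ENNReal.toReal_ofReal (hf0 r hr)]

lemma ae_densityMeasure_of_ae {p : ℝ → Prop} (h : ∀ᵐ r, 0 < r → p r) :
    ∀ᵐ r ∂densityMeasure f, p r :=
  (withDensity_absolutelyContinuous _ _).ae_le
    ((ae_restrict_iff' measurableSet_Ioi).2 h)

lemma isProbabilityMeasure_densityMeasure (hf0 : ∀ r, 0 < r → 0 ≤ f r)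
    (hI : IntegrableOn f (Set.Ioi 0)) (h1 : ∫ r in Set.Ioi 0, f r = 1) :
    IsProbabilityMeasure (densityMeasure f) := by
  refine ⟨?_⟩
  rw [densityMeasure, withDensity_apply _ MeasurableSet.univ, setLIntegral_univ,
    ← ofReal_integral_eq_lintegral_ofReal hI
      ((ae_restrict_iff' measurableSet_Ioi).2 (Eventually.of_forall hf0)), h1, ENNReal.ofReal_one]

lemma densityMeasure_real_Iio (hf : Measurable f) (hf0 : ∀ r, 0 < r → 0 ≤ f r) {r : ℝ}
    (hr : 0 < r) : (densityMeasure f).real (Set.Iio r) =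
      ∫ t in (0 : ℝ)..r, (Set.Ioi 0).indicator f t := by
  have h := integral_densityMeasure hf hf0 ((Set.Iio r).indicator 1)
  rw [integral_indicator_one measurableSet_Iio] at h
  rw [h, intervalIntegral.integral_of_le hr.le, integral_Ioc_eq_integral_Ioo,
    ← integral_indicator measurableSet_Ioi, ← integral_indicator measurableSet_Ioo]
  congr 1
  ext t
  by_cases h1 : 0 < t <;> by_cases h2 : t < r <;> simp [Set.indicator, h1, h2]

variable {q : ℝ → ℝ} {a β : ℝ}

lemma integrableOn_Ioc_rpow_mul (ha : -1 < a) (hq : Continuous q) :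
    IntegrableOn (fun r => r ^ a * q r) (Set.Ioc 0 1) :=
  (intervalIntegrable_iff_integrableOn_Ioc_of_le zero_le_one).1
    ((intervalIntegral.intervalIntegrable_rpow' ha).mul_continuousOn hq.continuousOn)

lemma integrableOn_Ioi_zero_iff {f : ℝ → ℝ} :
    IntegrableOn f (Set.Ioi 0) ↔ IntegrableOn f (Set.Ioc 0 1) ∧ IntegrableOn f (Set.Ioi 1) := by
  rw [← integrableOn_union, Set.Ioc_union_Ioi_eq_Ioi zero_le_one]

/-- The weight `2πrᵃq(r)`, corrected by the expected behaviour at infinity of a solution. -/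
def radialWeight (q : ℝ → ℝ) (a β r : ℝ) : ℝ := 2 * π * (r ^ a * q r) * exp (-(2 * β) * log⁺ r)

lemma measurable_radialWeight (hq : Continuous q) : Measurable (radialWeight q a β) := by
  have := hq.measurable
  unfold radialWeight
  fun_prop

lemma radialWeight_nonneg (hq0 : ∀ r, 0 ≤ q r) {r : ℝ} (hr : 0 < r) :
    0 ≤ radialWeight q a β r := by
  have := hq0 r
  unfold radialWeight
  positivity

lemma radialWeight_mul_exp_of_le_one {r c : ℝ} (hr : 0 < r) (hr1 : r ≤ 1) :
    radialWeight q a β r * exp (c * |log r|) = 2 * π * (r ^ (a - c) * q r) := by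
  rw [radialWeight, posLog_apply, max_eq_left (log_nonpos hr.le hr1),
    abs_of_nonpos (log_nonpos hr.le hr1), sub_eq_add_neg, rpow_add hr, rpow_def_of_pos hr (-c)]
  simp
  ring_nf

lemma radialWeight_mul_exp_of_one_le {r c : ℝ} (hr1 : 1 ≤ r) :
    radialWeight q a β r * exp (c * |log r|) = 2 * π * (r ^ (a - 2 * β + c) * q r) := by
  have hr : 0 < r := by linarith
  rw [radialWeight, posLog_apply, max_eq_right (log_nonneg hr1),
    abs_of_nonneg (log_nonneg hr1), sub_eq_add_neg, rpow_add hr, rpow_add hr,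
    rpow_def_of_pos hr (-(2 * β)), rpow_def_of_pos hr c]
  ring_nf

lemma integrableOn_radialWeight_mul_exp {c : ℝ} (hc : c - 1 < a) (hq : Continuous q)
    (hI : IntegrableOn (fun r => r ^ (a - 2 * β + c) * q r) (Set.Ici 1)) :
    IntegrableOn (fun r => radialWeight q a β r * exp (c * |log r|)) (Set.Ioi 0) := by
  refine integrableOn_Ioi_zero_iff.2 ⟨?_, ?_⟩
  · refine IntegrableOn.congr_fun
      ((integrableOn_Ioc_rpow_mul (a := a - c) (by linarith) hq).const_mul (2 * π))
      (fun r hr => ?_) measurableSet_Ioc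
    exact (radialWeight_mul_exp_of_le_one hr.1 hr.2).symm
  · refine IntegrableOn.congr_fun ((hI.mono_set Set.Ioi_subset_Ici_self).const_mul (2 * π))
      (fun r hr => ?_) measurableSet_Ioi
    exact (radialWeight_mul_exp_of_one_le (le_of_lt hr)).symm

lemma densityMeasure_radialWeight_ne_zero (hq : Continuous q) (hq0 : ∀ r, 0 ≤ q r)
    (hqne : ∃ r, 0 ≤ r ∧ q r ≠ 0) : densityMeasure (radialWeight q a β) ≠ 0 := by
  intro h
  have h1 := withDensity_eq_zero (measurable_radialWeight hq).ennreal_ofReal.aemeasurable h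
  rw [EventuallyEq, ae_restrict_iff' measurableSet_Ioi] at h1
  obtain ⟨r, hr, hqr⟩ := hqne
  have ho : IsOpen {r | q r ≠ 0} := isOpen_ne_fun hq continuous_const
  have hne : (Set.Ioi 0 ∩ {r | q r ≠ 0}).Nonempty := by
    have h2 : {r | q r ≠ 0} ∈ nhdsWithin r (Set.Ioi r) :=
      mem_nhdsWithin_of_mem_nhds (ho.mem_nhds hqr)
    obtain ⟨t, ht, ht'⟩ := (Filter.nonempty_of_mem (inter_mem h2 self_mem_nhdsWithin))
    exact ⟨t, hr.trans_lt ht', ht⟩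
  refine ((isOpen_Ioi.inter ho).measure_pos volume hne).ne' ?_
  refine measure_mono_null ?_ (ae_iff.1 h1)
  intro t ht ht'
  have h3 := ht' ht.1
  simp only [Pi.zero_apply, ENNReal.ofReal_eq_zero] at h3
  have h4 := (hq0 t).lt_of_ne' ht.2
  have h5 : 0 < t := ht.1
  have : 0 < radialWeight q a β t := by
    unfold radialWeight
    positivity
  linarith

lemma exists_radialMeanField (hβ : β ≠ 0) (ha : -1 < a) (haβ : β - 1 < a) (hq : Continuous q)
    (hq0 : ∀ r, 0 ≤ q r) (hqne : ∃ r, 0 ≤ r ∧ q r ≠ 0)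
    (hpos : 0 < β → ∃ δ : ℝ, 0 < δ ∧
      IntegrableOn (fun r => r ^ (a - β + δ) * q r) (Set.Ici 1))
    (hneg : β < 0 → IntegrableOn (fun r => r ^ (a - 2 * β) * q r) (Set.Ici 1)) :
    ∃ (w : ℝ → ℝ) (C Z : ℝ), Continuous w ∧ (∀ s, |w s| ≤ C * √|s|) ∧ 0 < Z ∧
      ∫ r in Set.Ioi 0, radialWeight q a β r * exp (w (log r)) = Z ∧
      ∀ s, w s = 2 * β / Z * ∫ r in Set.Ioi 0,
        radialWeight q a β r * (exp (w (log r)) * dirichletKernel s (log r)) := by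
  have hm := measurable_radialWeight (a := a) (β := β) hq
  have h0 (r : ℝ) (hr : 0 < r) : 0 ≤ radialWeight q a β r := radialWeight_nonneg hq0 hr
  have hν := densityMeasure_radialWeight_ne_zero (a := a) (β := β) hq hq0 hqne
  have key : ∃ (w : ℝ → ℝ) (C : ℝ), Continuous w ∧ (∀ s, |w s| ≤ C * √|s|) ∧
      0 < ∫ r, exp (w (log r)) ∂densityMeasure (radialWeight q a β) ∧ ∀ s, w s =
        2 * β / (∫ r, exp (w (log r)) ∂densityMeasure (radialWeight q a β)) *
          ∫ r, exp (w (log r)) * dirichletKernel s (log r)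
            ∂densityMeasure (radialWeight q a β) := by
    rcases hβ.lt_or_gt with h | h
    · have hfin : IsFiniteMeasure (densityMeasure (radialWeight q a β)) := by
        rw [← integrable_const_iff_isFiniteMeasure (one_ne_zero (α := ℝ)),
          integrable_densityMeasure_iff hm h0]
        simpa using integrableOn_radialWeight_mul_exp (c := 0) (β := β) (by simpa using ha) hq
          (by simpa using hneg h)
      exact exists_expMeanField_of_neg hν measurable_log (by linarith)
    · obtain ⟨δ, hδ, hI⟩ := hpos h
      set η := min δ ((a + 1 - β) / 2) with hη
      have hη0 : 0 < η := lt_min hδ (by linarith)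
      have hη1 : η ≤ δ := min_le_left _ _
      have hη2 : η ≤ (a + 1 - β) / 2 := min_le_right _ _
      refine exists_expMeanField_of_pos hν measurable_log (by linarith) (c := β + η)
        (by linarith) ?_
      rw [integrable_densityMeasure_iff hm h0]
      refine integrableOn_radialWeight_mul_exp (by linarith) hq (hI.mono' ?_ ?_)
      · have := hq.measurable
        exact Measurable.aestronglyMeasurable (by fun_prop)
      · refine (ae_restrict_iff' measurableSet_Ici).2 (Eventually.of_forall fun r hr => ?_)
        have hr1 : 1 ≤ r := hr
        have := hq0 r
        rw [norm_of_nonneg (by positivity)]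
        exact mul_le_mul_of_nonneg_right (rpow_le_rpow_of_exponent_le hr1 (by linarith)) this
  obtain ⟨w, C, hw, hC, hZ, h⟩ := key
  simp only [integral_densityMeasure hm h0] at hZ h
  exact ⟨w, C, _, hw, hC, hZ, rfl, h⟩

end RadialMeanField

section Profile

variable {q w : ℝ → ℝ} {a β C : ℝ}

lemma integrableOn_radialWeight_mul_rpow_neg {α : ℝ} (hα : 0 < α) (hαa : 2 * α - 1 < a)
    (hq : Continuous q) (hq0 : ∀ r, 0 ≤ q r) (hw : Continuous w) (hC : ∀ s, |w s| ≤ C * √|s|)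
    (hI : IntegrableOn (fun r => radialWeight q a β r * exp (w (log r))) (Set.Ioi 0)) :
    IntegrableOn (fun r => radialWeight q a β r * exp (w (log r)) * r ^ (-α)) (Set.Ioi 0) := by
  have hm : Measurable fun r => radialWeight q a β r * exp (w (log r)) * r ^ (-α) := by
    have := measurable_radialWeight (a := a) (β := β) hq
    have := hw.measurable
    fun_prop
  refine integrableOn_Ioi_zero_iff.2 ⟨?_, ?_⟩
  · refine ((integrableOn_Ioc_rpow_mul (a := a - 2 * α) (by linarith) hq).const_mul
      (exp (C ^ 2 / (4 * α)) * (2 * π))).mono' hm.aestronglyMeasurable ?_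
    refine (ae_restrict_iff' measurableSet_Ioc).2 (Eventually.of_forall fun r hr => ?_)
    have hr0 : 0 < r := hr.1
    have h0 := radialWeight_nonneg (a := a) (β := β) hq0 hr0
    have h1 : r ^ (-α) = exp (α * |log r|) := by
      rw [rpow_def_of_pos hr0, abs_of_nonpos (log_nonpos hr0.le hr.2)]
      ring_nf
    rw [norm_of_nonneg (by positivity)]
    calc radialWeight q a β r * exp (w (log r)) * r ^ (-α)
        ≤ radialWeight q a β r * (exp (C ^ 2 / (4 * α)) * exp (α * |log r|)) * r ^ (-α) := by
          gcongr
          exact exp_le_of_abs_le_mul_sqrt hα (hC _)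
      _ = exp (C ^ 2 / (4 * α)) * (radialWeight q a β r * exp (2 * α * |log r|)) := by
          rw [h1, two_mul α, add_mul, exp_add]
          ring
      _ = _ := by
          rw [radialWeight_mul_exp_of_le_one hr0 hr.2]
          ring
  · refine Integrable.mono' (hI.mono_set (Set.Ioi_subset_Ioi zero_le_one))
      hm.aestronglyMeasurable ?_
    refine (ae_restrict_iff' measurableSet_Ioi).2 (Eventually.of_forall fun r hr => ?_)
    have hr1 : 1 ≤ r := le_of_lt hr
    have h0 := radialWeight_nonneg (a := a) (β := β) hq0 (zero_lt_one.trans_le hr1)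
    rw [norm_of_nonneg (by positivity)]
    exact mul_le_of_le_one_right (by positivity) (rpow_le_one_of_one_le_of_nonpos hr1 (by linarith))

lemma exists_radialProfile (hβ : β ≠ 0) (ha : -1 < a) (haβ : β - 1 < a) (hq : Continuous q)
    (hq0 : ∀ r, 0 ≤ q r) (hqne : ∃ r, 0 ≤ r ∧ q r ≠ 0)
    (hpos : 0 < β → ∃ δ : ℝ, 0 < δ ∧
      IntegrableOn (fun r => r ^ (a - β + δ) * q r) (Set.Ici 1))
    (hneg : β < 0 → IntegrableOn (fun r => r ^ (a - 2 * β) * q r) (Set.Ici 1)) :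
    ∃ (u m : ℝ → ℝ) (α C : ℝ), 0 < α ∧ α ≤ 1 ∧
      (∀ r s, 0 ≤ r → 0 ≤ s → |u r - u s| ≤ C * |r - s| ^ α) ∧ Continuous m ∧ m 0 = 0 ∧
      (∀ r, 0 < r → HasDerivAt u (-(2 * β * m r) / r) r) ∧
      (∀ r, 0 < r → HasDerivAt m (2 * π * (r ^ a * q r * exp (u r))) r) ∧
      IntegrableOn (fun r => r ^ a * q r * exp (u r)) (Set.Ioi 0) ∧
      2 * π * ∫ r in Set.Ioi 0, r ^ a * q r * exp (u r) = 1 ∧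
      Tendsto (fun r => u r / log r) atTop (nhds (-(2 * β))) := by
  obtain ⟨w, C, Z, hw, hC, hZ0, hZ, hwZ⟩ :=
    exists_radialMeanField hβ ha haβ hq hq0 hqne hpos hneg
  set p : ℝ → ℝ := fun r => Z⁻¹ * (radialWeight q a β r * exp (w (log r))) with hp
  have hpm : Measurable p := by
    have := measurable_radialWeight (a := a) (β := β) hq
    have := hw.measurable
    fun_prop
  have hp0 (r : ℝ) (hr : 0 < r) : 0 ≤ p r := by
    have := radialWeight_nonneg (a := a) (β := β) hq0 hr
    positivity
  have hintw : IntegrableOn (fun r => radialWeight q a β r * exp (w (log r))) (Set.Ioi 0) := by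
    by_contra h
    rw [integral_undef h] at hZ
    exact hZ0.ne hZ
  have hpint : IntegrableOn p (Set.Ioi 0) := hintw.const_mul _
  have hp1 : ∫ r in Set.Ioi 0, p r = 1 := by
    rw [integral_const_mul, hZ, inv_mul_cancel₀ hZ0.ne']
  set μ := densityMeasure p with hμ
  have hprob : IsProbabilityMeasure μ := isProbabilityMeasure_densityMeasure hp0 hpint hp1
  have hμpos : ∀ᵐ ρ ∂μ, 0 < ρ := ae_densityMeasure_of_ae (Eventually.of_forall fun r hr => hr)
  have hμne (r : ℝ) : ∀ᵐ ρ ∂μ, ρ ≠ r :=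
    ae_densityMeasure_of_ae ((Measure.ae_ne volume r).mono fun ρ h _ => h)
  obtain ⟨α, hα, hα1, hαa⟩ : ∃ α : ℝ, 0 < α ∧ α ≤ 1 ∧ 2 * α - 1 < a :=
    ⟨min 1 ((a + 1) / 4), lt_min one_pos (by linarith), min_le_left _ _, by
      linarith [min_le_right 1 ((a + 1) / 4)]⟩
  have hαint : Integrable (fun ρ => ρ ^ (-α)) μ := by
    rw [hμ, integrable_densityMeasure_iff hpm hp0]
    refine IntegrableOn.congr_fun
      ((integrableOn_radialWeight_mul_rpow_neg hα hαa hq hq0 hw hC hintw).const_mul Z⁻¹)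
      (fun r _ => ?_) measurableSet_Ioi
    simp only [hp, mul_assoc]
  set A := logPotential μ 1 with hA
  set u : ℝ → ℝ := fun r => 2 * β * (A - logPotential μ r) - log Z with hu
  have hwu (r : ℝ) (hr : 0 < r) : w (log r) = 2 * β * (log⁺ r - logPotential μ r + A) := by
    have h1 : w (log r) = 2 * β * ∫ ρ, dirichletKernel (log r) (log ρ) ∂μ := by
      rw [hμ, integral_densityMeasure hpm hp0, hwZ]
      simp only [hp, mul_assoc, integral_const_mul]
      ring
    have h2 : ∫ ρ, dirichletKernel (log r) (log ρ) ∂μ =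
        ∫ ρ, (log⁺ r - log⁺ (r / ρ) + log⁺ (1 / ρ)) ∂μ := by
      refine integral_congr_ae ?_
      filter_upwards [hμpos] with ρ hρ
      rw [dirichletKernel_eq, posLog_div_eq hr hρ, posLog_div_eq one_pos hρ, log_one, zero_sub,
        posLog_apply, max_comm 0]
    have h3 := integrable_posLog_div hμpos hα hα1 hαint hr.le
    have h4 : Integrable (fun ρ => log⁺ r - log⁺ (r / ρ)) μ := (integrable_const _).sub h3
    rw [h1, h2, integral_add h4 (integrable_posLog_div hμpos hα hα1 hαint zero_le_one),
      integral_sub (integrable_const _) h3]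
    simp [hA, logPotential]
  have hpu (r : ℝ) (hr : 0 < r) : p r = 2 * π * (r ^ a * q r * exp (u r)) := by
    have h1 : exp (u r) = Z⁻¹ * (exp (-(2 * β) * log⁺ r) * exp (w (log r))) := by
      rw [hwu r hr, ← exp_add, ← exp_log (inv_pos.2 hZ0), ← exp_add, log_inv]
      simp only [hu]
      ring_nf
    rw [h1, hp]
    simp only [radialWeight]
    ring
  have hholder (r s : ℝ) (hr : 0 ≤ r) (hs : 0 ≤ s) :
      |u r - u s| ≤ |2 * β| * ((∫ ρ, ρ ^ (-α) ∂μ) / α) * |r - s| ^ α := by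
    have h1 : u r - u s = -(2 * β * (logPotential μ r - logPotential μ s)) := by
      simp only [hu]
      ring
    rw [h1, abs_neg, abs_mul, mul_assoc]
    exact mul_le_mul_of_nonneg_left (abs_logPotential_sub_le hμpos hα hα1 hαint hr hs)
      (abs_nonneg _)
  have hu' (r : ℝ) (hr : 0 < r) : HasDerivAt u (-(2 * β * μ.real (Set.Iio r)) / r) r := by
    refine ((((hasDerivAt_logPotential hμpos hα hα1 hαint hr (hμne r)).const_sub A).const_mul
      (2 * β)).sub_const (log Z)).congr_deriv ?_
    ring
  have hii : Integrable ((Set.Ioi 0).indicator p) :=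
    (integrable_indicator_iff measurableSet_Ioi).2 hpint
  refine ⟨u, fun r => ∫ t in (0 : ℝ)..r, (Set.Ioi 0).indicator p t, α, _, hα, hα1, hholder,
    intervalIntegral.continuous_primitive (fun _ _ => hii.intervalIntegrable) 0, by simp,
    fun r hr => ?_, fun r hr => ?_, ?_, ?_, ?_⟩
  · simpa only [← densityMeasure_real_Iio hpm hp0 hr] using hu' r hr
  · have hc : ContinuousAt ((Set.Ioi 0).indicator p) r := by
      have h1 : ContinuousAt (fun t => 2 * π * (t ^ a * q t * exp (u t))) r := by
        have := (continuousAt_id (x := r)).rpow_const (p := a) (Or.inl hr.ne')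
        have := (hu' r hr).continuousAt
        have := hq.continuousAt (x := r)
        fun_prop
      refine h1.congr ?_
      filter_upwards [Ioi_mem_nhds hr] with t ht
      rw [Set.indicator_of_mem (Set.mem_Ioi.2 ht), hpu t ht]
    have := intervalIntegral.integral_hasDerivAt_right (hii.intervalIntegrable (a := 0) (b := r))
      (hpm.indicator measurableSet_Ioi).stronglyMeasurable.stronglyMeasurableAtFilter hc
    rwa [Set.indicator_of_mem (Set.mem_Ioi.2 hr), hpu r hr] at this
  · have h1 := (hpint.congr_fun hpu measurableSet_Ioi).const_mul (2 * π)⁻¹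
    refine IntegrableOn.congr_fun h1 (fun r _ => ?_) measurableSet_Ioi
    field_simp
  · rw [← integral_const_mul, ← setIntegral_congr_fun measurableSet_Ioi hpu, hp1]
  · have h1 := (((tendsto_log_atTop.const_div_atTop (2 * β * A - log Z))).sub
      ((tendsto_logPotential_div_log hμpos hα hα1 hαint).const_mul (2 * β)))
    simp only [mul_one, zero_sub] at h1
    refine h1.congr fun r => ?_
    simp only [hu]
    ring

end Profile

section RadialFunctions

lemma integral_radial (f : ℝ → ℝ) :
    ∫ x : R2, f ‖x‖ = 2 * π * ∫ r in Set.Ioi 0, r * f r := by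
  have h := integral_fun_norm_addHaar (volume : Measure R2) f
  simp only [finrank_euclideanSpace, Fintype.card_fin, smul_eq_mul, nsmul_eq_mul,
    Nat.add_one_sub_one, pow_one] at h
  rw [h, Measure.real, EuclideanSpace.volume_ball_fin_two]
  simp [pi_pos.le]
  ring

lemma continuousOn_of_abs_sub_le {u : ℝ → ℝ} {α C : ℝ} (hα : 0 < α)
    (hu : ∀ r s, 0 ≤ r → 0 ≤ s → |u r - u s| ≤ C * |r - s| ^ α) :
    ContinuousOn u (Set.Ici 0) := by
  intro r hr
  rw [ContinuousWithinAt, tendsto_iff_norm_sub_tendsto_zero]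
  have h : Continuous fun s => C * |s - r| ^ α :=
    continuous_const.mul ((continuous_id.sub continuous_const).abs.rpow_const fun _ => Or.inr hα.le)
  have h0 : Tendsto (fun s => C * |s - r| ^ α) (nhdsWithin r (Set.Ici 0)) (nhds 0) := by
    simpa [zero_rpow hα.ne'] using (h.tendsto r).mono_left nhdsWithin_le_nhds
  refine squeeze_zero' (Eventually.of_forall fun _ => norm_nonneg _) ?_ h0
  filter_upwards [self_mem_nhdsWithin] with s hs
  exact hu s r hs hr

lemma exists_holderOnWith_comp_norm {u : ℝ → ℝ} {α : ℝ≥0} {C : ℝ}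
    (hu : ∀ r s, 0 ≤ r → 0 ≤ s → |u r - u s| ≤ C * |r - s| ^ (α : ℝ)) (K : Set R2) :
    ∃ Ch : ℝ≥0, HolderOnWith Ch α (fun x => u ‖x‖) K := by
  refine ⟨C.toNNReal, fun x _ y _ => ?_⟩
  rw [edist_nndist, edist_nndist, ← ENNReal.coe_rpow_of_nonneg _ α.coe_nonneg, ← ENNReal.coe_mul,
    ENNReal.coe_le_coe, ← NNReal.coe_le_coe]
  push_cast
  rw [dist_eq, dist_eq_norm]
  refine (hu _ _ (norm_nonneg x) (norm_nonneg y)).trans ?_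
  gcongr
  · exact le_max_left _ _
  · exact abs_norm_sub_norm_le x y

lemma contDiffOn_comp_norm {u u' : ℝ → ℝ} (hu : ∀ r, 0 < r → HasDerivAt u (u' r) r)
    (hu' : ContinuousOn u' (Set.Ioi 0)) :
    ContDiffOn ℝ 1 (fun x : R2 => u ‖x‖) {(0 : R2)}ᶜ := by
  have h : ContDiffOn ℝ 1 u (Set.Ioi 0) := by
    rw [contDiffOn_one_iff_derivWithin (uniqueDiffOn_Ioi 0)]
    refine ⟨fun r hr => (hu r hr).differentiableAt.differentiableWithinAt, hu'.congr fun r hr => ?_⟩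
    rw [derivWithin_of_isOpen isOpen_Ioi hr, (hu r hr).deriv]
  exact h.comp (fun x hx => (contDiffAt_norm ℝ hx).contDiffWithinAt) fun x hx => norm_pos_iff.2 hx

end RadialFunctions

/-- Corollary 1.8 (existence part): existence of a radially symmetric, locally
Hölder continuous solution of -Δψ = 4πβ‖x‖ⁿV e^ψ for radially decreasing V. -/
theorem existence_weighted_decreasing (β n : ℝ) (hβ : β ≠ 0) (hn : -2 < n)
    (hnβ : β - 2 < n)
    (V : R2 → ℝ) (v : ℝ → ℝ) (hprof : ∀ x : R2, V x = v ‖x‖)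
    (hV0 : ∀ x, 0 ≤ V x) (hVne : ∃ x, V x ≠ 0) (hVrad : RadSym V)
    (hVdec : ∀ x y : R2, ‖y‖ ≤ ‖x‖ → V x ≤ V y)
    (hVcont : Continuous V) (hVC1 : ContDiffOn ℝ 1 V {(0:R2)}ᶜ)
    (hrv : ∃ w : ℝ → ℝ, ContinuousOn w (Set.Ici 0) ∧
      ∀ r : ℝ, 0 < r → w r = r * deriv v r)
    (hpos : 0 < β → ∃ δ : ℝ, 0 < δ ∧
      IntegrableOn (fun r : ℝ => r ^ (n + 1 - β + δ) * v r) (Set.Ici (1:ℝ)))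
    (hneg : β < 0 →
      IntegrableOn (fun r : ℝ => r ^ (n + 1 - 2*β) * v r) (Set.Ici (1:ℝ))) :
    ∃ (ψ : R2 → ℝ) (α : ℝ≥0), 0 < α ∧ (α : ℝ) ≤ 1 ∧ RadSym ψ ∧
      ContDiffOn ℝ 1 ψ {(0:R2)}ᶜ ∧
      (∀ K : Set R2, IsCompact K → ∃ Ch : ℝ≥0, HolderOnWith Ch α ψ K) ∧
      IsWeakSol ψ (fun x => 4 * π * β * ‖x‖ ^ n * V x * Real.exp (ψ x)) ∧
      (∫ x : R2, ‖x‖ ^ n * V x * Real.exp (ψ x)) = 1 ∧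
      Tendsto (fun x : R2 => ψ x / Real.log ‖x‖) (cobounded R2) (nhds (-(2*β))) := by
  obtain ⟨q, hq⟩ : ∃ q : ℝ → ℝ, q = fun r => v |r| := ⟨_, rfl⟩
  have hqV (r : ℝ) : q r = V (r • EuclideanSpace.single 0 1) := by
    rw [hq, hprof, norm_smul]
    simp
  have hqv (r : ℝ) (hr : 0 ≤ r) : q r = v r := by simp only [hq, abs_of_nonneg hr]
  have hVq (x : R2) : V x = q ‖x‖ := by rw [hqv _ (norm_nonneg x), hprof]
  have hqc : Continuous q := by
    rw [show q = fun r => V (r • EuclideanSpace.single 0 1) from funext hqV]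
    fun_prop
  have hI (c : ℝ) (h : IntegrableOn (fun r : ℝ => r ^ c * v r) (Set.Ici (1 : ℝ))) :
      IntegrableOn (fun r : ℝ => r ^ c * q r) (Set.Ici (1 : ℝ)) := by
    refine IntegrableOn.congr_fun h (fun r hr => ?_) measurableSet_Ici
    have hr1 : 1 ≤ r := hr
    simp only [hqv r (by linarith)]
  obtain ⟨u, m, α, C, hα, hα1, hu, hm, hm0, hu', hm', hi, hi1, hlim⟩ :=
    exists_radialProfile (a := n + 1) hβ (by linarith) (by linarith) hqc
      (fun r => by rw [hqV]; exact hV0 _)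
      (hVne.imp' norm fun x hx => ⟨norm_nonneg x, by rwa [← hVq]⟩)
      (fun h => (hpos h).imp fun δ hδ => ⟨hδ.1, hI _ hδ.2⟩) (fun h => hI _ (hneg h))
  have hfe (r : ℝ) (hr : 0 < r) :
      r ^ (n + 1) * q r * exp (u r) = r * (r ^ n * q r * exp (u r)) := by
    rw [rpow_add hr, rpow_one]
    ring
  have huc := continuousOn_of_abs_sub_le hα hu
  have hweak : IsWeakSol (fun x => u ‖x‖)
      (fun x => 4 * π * β * ‖x‖ ^ n * V x * Real.exp (u ‖x‖)) := by
    have h := isWeakSol_of_radial (c := 2 * β) (f := fun r => r ^ n * q r * exp (u r)) huc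
      hm.continuousOn hm0 (fun R _ => IntegrableOn.congr_fun
        (hi.mono_set Set.Ioc_subset_Ioi_self) (fun r hr => hfe r hr.1) measurableSet_Ioc) hu'
      (fun r hr => by rw [← hfe r hr]; exact hm' r hr)
    have hg : (fun x : R2 => 4 * π * β * ‖x‖ ^ n * V x * exp (u ‖x‖)) =
        fun x : R2 => 2 * π * (2 * β) * (‖x‖ ^ n * q ‖x‖ * exp (u ‖x‖)) := by
      funext x
      rw [hVq]
      ring
    rw [hg]
    exact h
  have hmass : ∫ x : R2, ‖x‖ ^ n * V x * exp (u ‖x‖) = 1 := by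
    simp only [hVq]
    rw [integral_radial fun r => r ^ n * q r * exp (u r), ← hi1,
      setIntegral_congr_fun measurableSet_Ioi fun r hr => hfe r hr]
  have hu'c : ContinuousOn (fun r => -(2 * β * m r) / r) (Set.Ioi 0) :=
    ((hm.continuousOn.const_mul _).neg).div continuousOn_id fun r hr => (ne_of_gt hr)
  lift α to ℝ≥0 using hα.le
  exact ⟨fun x => u ‖x‖, α, hα, hα1, fun x y hxy => congrArg u hxy,
    contDiffOn_comp_norm hu' hu'c, fun K _ => exists_holderOnWith_comp_norm hu K, hweak, hmass,
    hlim.comp tendsto_norm_cobounded_atTop⟩
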